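/- For any i ∈ [n−2], we have [t_i, t_{i+2}] (t_i − 1) = t_{i+1} [t_i, t_{i+1}] in k[S_n]. -/

import Mathlib

/-- The simple transposition `s_i ∈ S_n` (1-based indexing), swapping `i` and `i+1`,
defined as the identity for `i` outside `{1, …, n-1}`. -/
def simpleTransposition (n i : ℕ) : Equiv.Perm (Fin n) :=
  if h : 1 ≤ i ∧ i < n then
    Equiv.swap ⟨i - 1, by omega⟩ ⟨i, h.2⟩
  else 1

/-- The cycle `(v ⟹ w) = s_v s_{v+1} ⋯ s_{w-1} ∈ S_n`, sending
`v ↦ v+1 ↦ ⋯ ↦ w ↦ v` (and equal to the identity when `v = w`). -/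
def cyc (n v w : ℕ) : Equiv.Perm (Fin n) :=
  ((List.range' v (w - v)).map (simpleTransposition n)).prod

/-- The somewhere-to-below shuffle `t_ℓ = Σ_{w=ℓ}^{n} (ℓ ⟹ w)` in the group
algebra `R[S_n]`. -/
noncomputable def t (R : Type*) [CommRing R] (n ℓ : ℕ) :
    MonoidAlgebra R (Equiv.Perm (Fin n)) :=
  ∑ w ∈ Finset.Icc ℓ n, MonoidAlgebra.of R (Equiv.Perm (Fin n)) (cyc n ℓ w)

theorem simpleTransposition_mul_self (n i : ℕ) :
    simpleTransposition n i * simpleTransposition n i = 1 := by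
  unfold simpleTransposition
  split_ifs
  · exact Equiv.swap_mul_self _ _
  · exact one_mul 1

theorem simpleTransposition_commute (n : ℕ) {i j : ℕ} (hij : i + 2 ≤ j) :
    Commute (simpleTransposition n i) (simpleTransposition n j) := by
  unfold simpleTransposition
  split_ifs
  · apply Equiv.Perm.Disjoint.commute
    intro x
    rw [or_iff_not_imp_left]
    intro hx
    apply Equiv.swap_apply_of_ne_of_ne <;> rintro rfl <;> apply hx <;>
      apply Equiv.swap_apply_of_ne_of_ne <;> simp only [ne_eq, Fin.mk.injEq] <;> omega
  · exact Commute.one_right _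
  · exact Commute.one_left _
  · exact Commute.one_left _

theorem swap_braid {α : Type*} [DecidableEq α] {a b c : α} (hab : a ≠ b) (hbc : b ≠ c)
    (hac : a ≠ c) :
    Equiv.swap a b * Equiv.swap b c * Equiv.swap a b =
      Equiv.swap b c * Equiv.swap a b * Equiv.swap b c := by
  rw [Equiv.swap_mul_swap_mul_swap hab hac, Equiv.swap_comm a b, Equiv.swap_comm b c,
    Equiv.swap_mul_swap_mul_swap hbc.symm hac.symm, Equiv.swap_comm]

theorem simpleTransposition_braid {n i : ℕ} (hi : 1 ≤ i) (hin : i + 1 < n) :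
    simpleTransposition n i * simpleTransposition n (i + 1) * simpleTransposition n i =
      simpleTransposition n (i + 1) * simpleTransposition n i *
        simpleTransposition n (i + 1) := by
  have h₁ : 1 ≤ i ∧ i < n := ⟨hi, by omega⟩
  have h₂ : 1 ≤ i + 1 ∧ i + 1 < n := ⟨by omega, hin⟩
  simp only [simpleTransposition, dif_pos h₁, dif_pos h₂, Nat.add_sub_cancel]
  apply swap_braid <;> simp only [ne_eq, Fin.mk.injEq] <;> omega

theorem cyc_self (n v : ℕ) : cyc n v v = 1 := by
  simp [cyc]

theorem cyc_eq_mul {n v w : ℕ} (h : v < w) :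
    cyc n v w = simpleTransposition n v * cyc n (v + 1) w := by
  obtain ⟨d, rfl⟩ := Nat.exists_eq_add_of_lt h
  have h₁ : v + d + 1 - v = d + 1 := by omega
  have h₂ : v + d + 1 - (v + 1) = d := by omega
  rw [cyc, cyc, h₁, h₂, List.range'_succ, List.map_cons, List.prod_cons]

theorem simpleTransposition_commute_cyc (n : ℕ) {i v : ℕ} (h : i + 2 ≤ v) (w : ℕ) :
    Commute (simpleTransposition n i) (cyc n v w) := by
  apply Commute.list_prod_right
  intro x hx
  obtain ⟨j, hj, rfl⟩ := List.mem_map.mp hx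
  exact simpleTransposition_commute n (h.trans (List.mem_range'_1.mp hj).1)

section Shuffles

variable (R : Type*) [CommRing R]

theorem t_self (n : ℕ) : t R n n = 1 := by
  simp [t, cyc_self, MonoidAlgebra.one_def]

theorem t_eq_one_add {n i : ℕ} (h : i ≤ n) :
    t R n i = 1 + MonoidAlgebra.of R _ (simpleTransposition n i) * t R n (i + 1) := by
  rw [t, ← Finset.insert_Icc_add_one_left_eq_Icc h, Finset.sum_insert (by simp), cyc_self,
    map_one, t, Finset.mul_sum]
  congr 1
  refine Finset.sum_congr rfl fun w hw => ?_
  rw [cyc_eq_mul (Finset.mem_Icc.mp hw).1, map_mul]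

theorem of_simpleTransposition_commute_t (n : ℕ) {i ℓ : ℕ} (h : i + 2 ≤ ℓ) :
    Commute (MonoidAlgebra.of R _ (simpleTransposition n i)) (t R n ℓ) :=
  Commute.sum_right _ _ _ fun w _ => (simpleTransposition_commute_cyc n h w).map _

theorem of_simpleTransposition_mul_t_mul_t {n i : ℕ} (hi : 1 ≤ i) (hin : i < n) :
    MonoidAlgebra.of R _ (simpleTransposition n i) * (t R n (i + 1) * t R n i) =
      t R n (i + 1) * t R n i := by
  obtain ⟨d, rfl⟩ := Nat.exists_eq_add_of_lt hin
  induction d generalizing i with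
  | zero =>
    have hs := congrArg (MonoidAlgebra.of R _) (simpleTransposition_mul_self (i + 0 + 1) i)
    rw [map_mul, map_one] at hs
    rw [t_eq_one_add R hin.le, t_self, one_mul, mul_one, mul_add, mul_one, hs,
      add_comm (1 : MonoidAlgebra R _)]
  | succ d ih =>
    have ih := @ih (i + 1) (by omega) (by omega)
    rw [show i + 1 + d + 1 = i + (d + 1) + 1 by omega] at ih
    have hsc := (of_simpleTransposition_commute_t R (i + (d + 1) + 1) (le_refl (i + 2))).eq
    have hss := congrArg (MonoidAlgebra.of R _)
      (simpleTransposition_mul_self (i + (d + 1) + 1) i)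
    have hbraid := congrArg (MonoidAlgebra.of R _)
      (simpleTransposition_braid (n := i + (d + 1) + 1) hi (by omega))
    rw [t_eq_one_add R hin.le]
    rw [t_eq_one_add R (by omega : i + 1 ≤ i + (d + 1) + 1)] at ih ⊢
    simp only [map_mul, map_one] at hss hbraid
    simp only [show i + 1 + 1 = i + 2 from rfl] at ih ⊢
    generalize t R (i + (d + 1) + 1) (i + 2) = c at *
    generalize MonoidAlgebra.of R _ (simpleTransposition (i + (d + 1) + 1) i) = s at *
    generalize MonoidAlgebra.of R _ (simpleTransposition (i + (d + 1) + 1) (i + 1)) = u at *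
    calc s * ((1 + u * c) * (1 + s * (1 + u * c)))
        = s + s * u * c + s * s + s * s * (u * c) + s * u * (c * s) * (1 + u * c) := by
          noncomm_ring
      _ = s + s * u * c + 1 + u * c + s * u * s * (c * (1 + u * c)) := by
          rw [hss, ← hsc]; noncomm_ring
      _ = s + s * u * c + 1 + u * c + u * s * (u * (c * (1 + u * c))) := by
          rw [hbraid]; noncomm_ring
      _ = s + s * u * c + 1 + u * c + u * (s * c) * (1 + u * c) := by
          rw [ih]; noncomm_ring
      _ = (1 + u * c) * (1 + s * (1 + u * c)) := by
          rw [hsc]; noncomm_ring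

/-- The Grinberg–Lafrenière relation `t_{i+1} t_i = (t_i - 1) t_i`. -/
theorem t_succ_mul_t {n i : ℕ} (hi : 1 ≤ i) (hin : i < n) :
    t R n (i + 1) * t R n i = (t R n i - 1) * t R n i := by
  rw [← of_simpleTransposition_mul_t_mul_t R hi hin, ← mul_assoc]
  congr 1
  rw [t_eq_one_add R hin.le, add_sub_cancel_left]

end Shuffles

theorem comm_ti_ti_plus_two_mul_ti_sub_one
    (R : Type*) [CommRing R] (n : ℕ) (hn : 0 < n)
    (i : ℕ) (hi1 : 1 ≤ i) (hin : i ≤ n - 2) :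
    (t R n i * t R n (i + 2) - t R n (i + 2) * t R n i) * (t R n i - 1)
      = t R n (i + 1) * (t R n i * t R n (i + 1) - t R n (i + 1) * t R n i) := by
  have hba := t_succ_mul_t R hi1 (show i < n by omega)
  have hcb := t_succ_mul_t R (show 1 ≤ i + 1 by omega) (show i + 1 < n by omega)
  have hsc := (of_simpleTransposition_commute_t R n (le_refl (i + 2))).eq
  have ha := t_eq_one_add R (show i ≤ n by omega)
  rw [show i + 1 + 1 = i + 2 from rfl] at hcb
  generalize t R n i = a at *
  generalize t R n (i + 1) = b at *
  generalize t R n (i + 2) = c at *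
  generalize MonoidAlgebra.of R _ (simpleTransposition n i) = s at *
  have hsb : s * b = a - 1 := by rw [ha, add_sub_cancel_left]
  have hca : c * (a - 1) = (a - 1) * (b - 1) := by
    calc c * (a - 1) = s * (c * b) := by rw [← hsb, ← mul_assoc, ← hsc, mul_assoc]
      _ = s * b * (b - 1) := by rw [hcb]; noncomm_ring
      _ = (a - 1) * (b - 1) := by rw [hsb]
  have hcaa : c * a * (a - 1) = a * (a - 1) * (a - 2) := by
    calc c * a * (a - 1) = c * (a - 1) * a := by noncomm_ring
      _ = (a - 1) * (b * a - a) := by rw [hca]; noncomm_ring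
      _ = a * (a - 1) * (a - 2) := by rw [hba]; noncomm_ring
  calc (a * c - c * a) * (a - 1) = a * (c * (a - 1)) - c * a * (a - 1) := by noncomm_ring
    _ = (a - 1) * a * (b - a + 1) := by rw [hca, hcaa]; noncomm_ring
    _ = b * a * b - b * a * a + b * a := by rw [hba]; noncomm_ring
    _ = b * (a * b - (a - 1) * a) := by noncomm_ring
    _ = b * (a * b - b * a) := by rw [hba]
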